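/- Define the six-loop twist-2 ABJM anomalous dimension as the function of N ∈ ℕ given by γ₆(N) = 128(S_{−5}+S₅) − 192(S_{−1,−4}+S_{1,−4}) − 192(S_{−1,4}+S_{1,4}) − 256(S_{−2,−3}+S_{2,−3}) − 256(S_{−2,3}+S_{2,3}) − 160(S_{−3,−2}+S_{3,−2}) − 160(S_{−3,2}+S_{3,2}) − 128(S_{−4,−1}+S_{4,−1}) − 128(S_{−4,1}+S_{4,1}) + 96(S_{−1,−3,−1}+S_{1,−3,−1}) + 96(S_{−1,−3,1}+S_{1,−3,1}) + 96(S_{−1,−2,−2}+S_{1,−2,−2}) + 96(S_{−1,−2,2}+S_{1,−2,2}) + 128(S_{−1,−1,−3}+S_{1,−1,−3}) + 128(S_{−1,−1,3}+S_{1,−1,3}) + 128(S_{−1,1,−3}+S_{1,1,−3}) + 128(S_{−1,1,3}+S_{1,1,3}) + 96(S_{−1,2,−2}+S_{1,2,−2}) + 96(S_{−1,2,2}+S_{1,2,2}) + 96(S_{−1,3,−1}+S_{1,3,−1}) + 96(S_{−1,3,1}+S_{1,3,1}) + 96(S_{−2,−2,−1}+S_{2,−2,−1}) + 96(S_{−2,−2,1}+S_{2,−2,1})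 + 80(S_{−2,−1,−2}+S_{2,−1,−2}) + 80(S_{−2,−1,2}+S_{2,−1,2}) + 80(S_{−2,1,−2}+S_{2,1,−2}) + 80(S_{−2,1,2}+S_{2,1,2}) + 96(S_{−2,2,−1}+S_{2,2,−1}) + 96(S_{−2,2,1}+S_{2,2,1}) + 32(S_{−3,−1,−1}+S_{3,−1,−1}) + 32(S_{−3,−1,1}+S_{3,−1,1}) + 32(S_{−3,1,−1}+S_{3,1,−1}) + 32(S_{−3,1,1}+S_{3,1,1}) − 32(S_{−1,−1,−2,−1}+S_{1,−1,−2,−1}) − 32(S_{−1,−1,−2,1}+S_{1,−1,−2,1}) − 32(S_{−1,−1,2,−1}+S_{1,−1,2,−1}) − 32(S_{−1,−1,2,1}+S_{1,−1,2,1}) − 32(S_{−1,1,−2,−1}+S_{1,1,−2,−1}) − 32(S_{−1,1,−2,1}+S_{1,1,−2,1}) − 32(S_{−1,1,2,−1}+S_{1,1,2,−1}) − 32(S_{−1,1,2,1}+S_{1,1,2,1}), where each nested harmonic sum is evaluated at N. Then γ₆(2n+1) = γ₆(2n) for every natural number n. -/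

import Mathlib

/-- Nested (signed) harmonic sum `S_{a₁,…,a_ℓ}(N)`,
`S_{a₁,…,a_ℓ}(N) = Σ_{n=1}^{N} (sign a₁)^n / n^{|a₁|} · S_{a₂,…,a_ℓ}(n)`, with `S_{}(n) = 1`. -/
noncomputable def nestedS : List ℤ → ℕ → ℝ
  | [], _ => 1
  | a :: b, N => ∑ n ∈ Finset.Icc 1 N, ((Int.sign a : ℝ)) ^ n / (n : ℝ) ^ a.natAbs * nestedS b n

/-- Six-loop twist-2 ABJM (asymptotic) anomalous dimension `γ₆^{ABA}(N)`. -/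
noncomputable def gammaSixTwistTwo (N : ℕ) : ℝ :=
  128 * (nestedS [-5] N + nestedS [5] N)
      - 192 * (nestedS [-1, -4] N + nestedS [1, -4] N)
      - 192 * (nestedS [-1, 4] N + nestedS [1, 4] N)
      - 256 * (nestedS [-2, -3] N + nestedS [2, -3] N)
      - 256 * (nestedS [-2, 3] N + nestedS [2, 3] N)
      - 160 * (nestedS [-3, -2] N + nestedS [3, -2] N)
      - 160 * (nestedS [-3, 2] N + nestedS [3, 2] N)
      - 128 * (nestedS [-4, -1] N + nestedS [4, -1] N)
      - 128 * (nestedS [-4, 1] N + nestedS [4, 1] N)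
      + 96 * (nestedS [-1, -3, -1] N + nestedS [1, -3, -1] N)
      + 96 * (nestedS [-1, -3, 1] N + nestedS [1, -3, 1] N)
      + 96 * (nestedS [-1, -2, -2] N + nestedS [1, -2, -2] N)
      + 96 * (nestedS [-1, -2, 2] N + nestedS [1, -2, 2] N)
      + 128 * (nestedS [-1, -1, -3] N + nestedS [1, -1, -3] N)
      + 128 * (nestedS [-1, -1, 3] N + nestedS [1, -1, 3] N)
      + 128 * (nestedS [-1, 1, -3] N + nestedS [1, 1, -3] N)
      + 128 * (nestedS [-1, 1, 3] N + nestedS [1, 1, 3] N)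
      + 96 * (nestedS [-1, 2, -2] N + nestedS [1, 2, -2] N)
      + 96 * (nestedS [-1, 2, 2] N + nestedS [1, 2, 2] N)
      + 96 * (nestedS [-1, 3, -1] N + nestedS [1, 3, -1] N)
      + 96 * (nestedS [-1, 3, 1] N + nestedS [1, 3, 1] N)
      + 96 * (nestedS [-2, -2, -1] N + nestedS [2, -2, -1] N)
      + 96 * (nestedS [-2, -2, 1] N + nestedS [2, -2, 1] N)
      + 80 * (nestedS [-2, -1, -2] N + nestedS [2, -1, -2] N)
      + 80 * (nestedS [-2, -1, 2] N + nestedS [2, -1, 2] N)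
      + 80 * (nestedS [-2, 1, -2] N + nestedS [2, 1, -2] N)
      + 80 * (nestedS [-2, 1, 2] N + nestedS [2, 1, 2] N)
      + 96 * (nestedS [-2, 2, -1] N + nestedS [2, 2, -1] N)
      + 96 * (nestedS [-2, 2, 1] N + nestedS [2, 2, 1] N)
      + 32 * (nestedS [-3, -1, -1] N + nestedS [3, -1, -1] N)
      + 32 * (nestedS [-3, -1, 1] N + nestedS [3, -1, 1] N)
      + 32 * (nestedS [-3, 1, -1] N + nestedS [3, 1, -1] N)
      + 32 * (nestedS [-3, 1, 1] N + nestedS [3, 1, 1] N)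
      - 32 * (nestedS [-1, -1, -2, -1] N + nestedS [1, -1, -2, -1] N)
      - 32 * (nestedS [-1, -1, -2, 1] N + nestedS [1, -1, -2, 1] N)
      - 32 * (nestedS [-1, -1, 2, -1] N + nestedS [1, -1, 2, -1] N)
      - 32 * (nestedS [-1, -1, 2, 1] N + nestedS [1, -1, 2, 1] N)
      - 32 * (nestedS [-1, 1, -2, -1] N + nestedS [1, 1, -2, -1] N)
      - 32 * (nestedS [-1, 1, -2, 1] N + nestedS [1, 1, -2, 1] N)
      - 32 * (nestedS [-1, 1, 2, -1] N + nestedS [1, 1, 2, -1] N)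
      - 32 * (nestedS [-1, 1, 2, 1] N + nestedS [1, 1, 2, 1] N)

/-- The sum of two nested sums whose leading indices are opposite picks up no contribution at odd
arguments. -/
theorem nestedS_neg_add_nestedS_two_mul_add_one (a : ℤ) (b : List ℤ) (n : ℕ) :
    nestedS (-a :: b) (2 * n + 1) + nestedS (a :: b) (2 * n + 1) =
      nestedS (-a :: b) (2 * n) + nestedS (a :: b) (2 * n) := by
  have hodd : (-(a.sign : ℝ)) ^ (2 * n + 1) = -(a.sign : ℝ) ^ (2 * n + 1) :=
    (odd_two_mul_add_one n).neg_pow _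
  simp only [nestedS, Finset.sum_Icc_succ_top (Nat.le_add_left 1 (2 * n)), Int.sign_neg,
    Int.cast_neg, Int.natAbs_neg, hodd]
  ring

/-- Shift symmetry of the six-loop twist-2 ABJM anomalous dimension:
`γ₆^{ABA}(2n+1) = γ₆^{ABA}(2n)`. -/
theorem twist2_six_loop_shift_symmetry (n : ℕ) :
    gammaSixTwistTwo (2 * n + 1) = gammaSixTwistTwo (2 * n) := by
  simp only [gammaSixTwistTwo, nestedS_neg_add_nestedS_two_mul_add_one]
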